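/- arXiv:2107.02856 — 2 statements merged into one kernel-verified Lean document; each statement's English description precedes it below -/
import Mathlib

section
/- Let f : ℝ^m → ℝⁿ be monotone (componentwise non-decreasing) and let y⁰ ∈ ℝⁿ have all components positive. Suppose x^t ∈ ℝ^m satisfies f(x^t)_i < y⁰_i for every index i. Then every x ∈ ℝ^m with x ⪯ x^t (componentwise ≤) satisfies h(f(x)) ≥ h(f(x^t)) > 0, where h is the calibration objective; i.e., every solution in the eliminated lower set B_t is at least as bad as x^t and strictly worse than the optimum value 0. -/
/-- If `f` is componentwise non-decreasing, `y₀` has positive components,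
and `f xᵗ i < y₀ i` for all `i`, then every `x ⪯ xᵗ` satisfies
`h(f x) ≥ h(f xᵗ) > 0`, where `h(y) = ∑ i, |1 - y i / y₀ i|`. -/
theorem eliminated_lower_set_at_least_as_bad
    (m n : ℕ) (hn : 0 < n) (f : (Fin m → ℝ) → (Fin n → ℝ))
    (hf : ∀ x x' : Fin m → ℝ, (∀ j, x j ≤ x' j) → ∀ i, f x i ≤ f x' i)
    (y₀ : Fin n → ℝ) (hy₀ : ∀ i, 0 < y₀ i)
    (xt : Fin m → ℝ) (ht : ∀ i, f xt i < y₀ i) :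
    ∀ x : Fin m → ℝ, (∀ j, x j ≤ xt j) →
      (∑ i, |1 - f xt i / y₀ i|) ≤ (∑ i, |1 - f x i / y₀ i|) ∧
        0 < ∑ i, |1 - f xt i / y₀ i| := by
  intro x hx
  have h1 : ∀ i, 0 < 1 - f xt i / y₀ i := fun i => by
    have := (div_lt_one (hy₀ i)).mpr (ht i)
    linarith
  constructor
  · apply Finset.sum_le_sum
    intro i _
    have h2 : f x i / y₀ i ≤ f xt i / y₀ i :=
      div_le_div_of_nonneg_right (hf x xt hx i) (hy₀ i).le
    rw [abs_of_pos (h1 i)]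
    exact le_trans (by linarith) (le_abs_self _)
  · apply Finset.sum_pos
    · intro i _
      exact abs_pos.mpr (h1 i).ne'
    · exact ⟨⟨0, hn⟩, Finset.mem_univ _⟩
end

section
/- Let f : ℝ^m → ℝⁿ be monotone (componentwise non-decreasing) and let y⁰ ∈ ℝⁿ have all components positive. Suppose x^t ∈ ℝ^m satisfies f(x^t)_i > y⁰_i for every index i. Then every x ∈ ℝ^m with x ⪰ x^t (componentwise ≥) satisfies h(f(x)) ≥ h(f(x^t)) > 0, where h is the calibration objective; i.e., every solution in the eliminated upper set C_t is at least as bad as x^t and strictly worse than the optimum value 0. -/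
/-- If `f` is componentwise non-decreasing, `y₀` has positive components,
and `f xᵗ i > y₀ i` for all `i`, then every `x ⪰ xᵗ` satisfies
`h(f x) ≥ h(f xᵗ) > 0`, where `h(y) = ∑ i, |1 - y i / y₀ i|`. -/
theorem eliminated_upper_set_at_least_as_bad
    (m n : ℕ) (hn : 0 < n) (f : (Fin m → ℝ) → (Fin n → ℝ))
    (hf : ∀ x x' : Fin m → ℝ, (∀ j, x j ≤ x' j) → ∀ i, f x i ≤ f x' i)
    (y₀ : Fin n → ℝ) (hy₀ : ∀ i, 0 < y₀ i)
    (xt : Fin m → ℝ) (ht : ∀ i, y₀ i < f xt i) :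
    ∀ x : Fin m → ℝ, (∀ j, xt j ≤ x j) →
      (∑ i, |1 - f xt i / y₀ i|) ≤ (∑ i, |1 - f x i / y₀ i|) ∧
        0 < ∑ i, |1 - f xt i / y₀ i| := by
  intro x hx
  have h1 : ∀ i, 1 < f xt i / y₀ i := fun i => (one_lt_div (hy₀ i)).2 (ht i)
  have h2 : ∀ i, f xt i / y₀ i ≤ f x i / y₀ i := fun i =>
    div_le_div_of_nonneg_right (hf xt x hx i) (hy₀ i).le
  refine ⟨Finset.sum_le_sum fun i _ => ?_, Finset.sum_pos (fun i _ => ?_) ⟨⟨0, hn⟩, Finset.mem_univ _⟩⟩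
  · have a := h1 i
    have b := h2 i
    rw [abs_of_neg (by linarith), abs_of_neg (by linarith)]
    linarith
  · have a := h1 i
    exact abs_pos.2 (by linarith)
end
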